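/- Let A ∈ ℝ^{m×n} be non-degenerate with largest eigenvalue of AᵀA at most 2n (as holds when A is obtained from the incidence matrix of a directed graph on n vertices), let d ∈ ℝ^n and μ > 0. Let x, s ∈ ℝ^m be entrywise positive satisfying xs ≈₁ μ·τ(x,s) entrywise, where τ(x,s) := σ(X^{1/2}S^{−1/2}A) + (n/m)·𝟙, and suppose x_i ≤ ‖d‖_∞ for every i. Define δ := (1/μ)·‖Aᵀx − d‖²_{(AᵀXS⁻¹A)⁻¹}. Then ‖Aᵀx − d‖₂² ≤ 6m·‖d‖_∞²·δ. -/

import Mathlib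

open Matrix Finset

/-- The orthogonal projection matrix `P(B) = B(BᵀB)⁻¹Bᵀ` onto the image of `B`. -/
noncomputable def projMat {m n : ℕ} (B : Matrix (Fin m) (Fin n) ℝ) :
    Matrix (Fin m) (Fin m) ℝ :=
  B * (Bᵀ * B)⁻¹ * Bᵀ

/-- The leverage scores `σ(B)ᵢ = P(B)ᵢᵢ`. -/
noncomputable def lev {m n : ℕ} (B : Matrix (Fin m) (Fin n) ℝ) (i : Fin m) : ℝ :=
  projMat B i i

/-- The Lee–Sidford weight function `τ(x,s) = σ(X^{1/2}S^{-1/2}A) + (n/m)𝟙` (here with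
exponent `α = 0`, matching the use in the demand-error bound). -/
noncomputable def lsWeight {m n : ℕ} (A : Matrix (Fin m) (Fin n) ℝ)
    (x s : Fin m → ℝ) (i : Fin m) : ℝ :=
  lev (Matrix.diagonal (fun j => Real.sqrt (x j / s j)) * A) i + (n : ℝ) / (m : ℝ)

/-- Leverage scores are nonnegative. -/
theorem lev_nonneg {m n : ℕ} (B : Matrix (Fin m) (Fin n) ℝ) (i : Fin m) : 0 ≤ lev B i := by
  have h := ((posSemidef_conjTranspose_mul_self B).inv).mul_mul_conjTranspose_same B
  simpa [lev, projMat, conjTranspose_eq_transpose_of_trivial] using h.diag_nonneg (i := i)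

/-- The quadratic form of `AᵀDA` with `D` diagonal is the weighted sum of squares of `Ay`. -/
theorem dotProduct_transpose_mul_diagonal_mul_mulVec {m n : ℕ} (A : Matrix (Fin m) (Fin n) ℝ)
    (w : Fin m → ℝ) (y : Fin n → ℝ) :
    y ⬝ᵥ ((Aᵀ * Matrix.diagonal w * A) *ᵥ y) = ∑ i, w i * (A *ᵥ y) i ^ 2 := by
  rw [← mulVec_mulVec, ← mulVec_mulVec, dotProduct_mulVec, vecMul_transpose]
  simp only [dotProduct, mulVec_diagonal]
  exact Finset.sum_congr rfl fun i _ => by ring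

/-- `AᵀDA` is positive definite when `A` has full column rank and `D` is a positive diagonal. -/
theorem posDef_transpose_mul_diagonal_mul {m n : ℕ} {A : Matrix (Fin m) (Fin n) ℝ}
    (hrank : A.rank = n) {w : Fin m → ℝ} (hw : ∀ i, 0 < w i) :
    (Aᵀ * Matrix.diagonal w * A).PosDef := by
  have hinj : Function.Injective A.mulVec := by
    rw [mulVec_injective_iff, linearIndependent_iff_card_eq_finrank_span]
    rw [Fintype.card_fin, Set.finrank, ← rank_eq_finrank_span_cols, hrank]
  simpa [conjTranspose_eq_transpose_of_trivial] using
    (PosDef.diagonal hw).conjTranspose_mul_mul_same hinj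

/-- If `0 ≺ M ⪯ C·I`, then `‖v‖² ≤ C‖v‖²_{M⁻¹}`. -/
theorem dotProduct_self_le_mul_dotProduct_inv_mulVec {n : ℕ} {M : Matrix (Fin n) (Fin n) ℝ}
    (hM : M.PosDef) {C : ℝ} (hC : 0 < C) (v : Fin n → ℝ)
    (hle : v ⬝ᵥ (M *ᵥ v) ≤ C * (v ⬝ᵥ v)) :
    v ⬝ᵥ v ≤ C * (v ⬝ᵥ (M⁻¹ *ᵥ v)) := by
  have hdet : IsUnit M.det := hM.det_pos.ne'.isUnit
  have hMw : M *ᵥ (M⁻¹ *ᵥ v) = v := by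
    rw [mulVec_mulVec, mul_nonsing_inv M hdet, one_mulVec]
  have hsymm : Mᵀ = M := by simpa [conjTranspose_eq_transpose_of_trivial] using hM.isHermitian.eq
  generalize M⁻¹ *ᵥ v = w at hMw ⊢
  have hwv : w ⬝ᵥ (M *ᵥ v) = v ⬝ᵥ v := by
    rw [dotProduct_mulVec, ← mulVec_transpose, hsymm, hMw]
  have h := hM.posSemidef.dotProduct_mulVec_nonneg (v - C • w)
  simp only [star_trivial, mulVec_sub, mulVec_smul, hMw, sub_dotProduct, dotProduct_sub,
    smul_dotProduct, dotProduct_smul, smul_eq_mul, hwv, dotProduct_comm w v] at h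
  nlinarith

/-- **Demand-error bound.**  Suppose `λ_max(AᵀA) ≤ 2n`, `xs ≈₁ μ·τ(x,s)` and
`x ≤ ‖d‖_∞` entrywise.  Then with
`δ = (1/μ)‖Aᵀx - d‖²_{(AᵀXS⁻¹A)⁻¹}` one has `‖Aᵀx - d‖₂² ≤ 6m‖d‖_∞²·δ`. -/
theorem demand_error_bound
    {m n : ℕ} (A : Matrix (Fin m) (Fin n) ℝ) (hrank : A.rank = n) (hrows : ∀ i, A i ≠ 0)
    (heig : ∀ y : Fin n → ℝ, y ⬝ᵥ ((Aᵀ * A) *ᵥ y) ≤ 2 * (n : ℝ) * (y ⬝ᵥ y))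
    (d : Fin n → ℝ) (μ : ℝ) (hμ : 0 < μ)
    (x s : Fin m → ℝ) (hx : ∀ i, 0 < x i) (hs : ∀ i, 0 < s i)
    (hcenter : ∀ i, Real.exp (-1) * (μ * lsWeight A x s i) ≤ x i * s i ∧
      x i * s i ≤ Real.exp 1 * (μ * lsWeight A x s i))
    (hxd : ∀ i, x i ≤ ‖d‖) :
    (Aᵀ *ᵥ x - d) ⬝ᵥ (Aᵀ *ᵥ x - d) ≤
      6 * (m : ℝ) * ‖d‖ ^ 2 *
        ((1 / μ) * ((Aᵀ *ᵥ x - d) ⬝ᵥ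
          ((Aᵀ * Matrix.diagonal (fun i => x i / s i) * A)⁻¹ *ᵥ (Aᵀ *ᵥ x - d)))) := by
  rcases Nat.eq_zero_or_pos n with rfl | hn
  · simp
  have hm : 0 < m := by
    have := A.rank_le_height
    omega
  have hd : 0 < ‖d‖ := (hx ⟨0, hm⟩).trans_le (hxd ⟨0, hm⟩)
  have hn' : (0 : ℝ) < n := Nat.cast_pos.2 hn
  have hm' : (0 : ℝ) < m := Nat.cast_pos.2 hm
  have hratio : ∀ i, x i / s i ≤ 3 * m * ‖d‖ ^ 2 / (μ * n) := by
    intro i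
    have hlev : (n : ℝ) / m ≤ lsWeight A x s i := le_add_of_nonneg_left (lev_nonneg _ i)
    have hexp : (1 / 3 : ℝ) ≤ Real.exp (-1) := by
      rw [Real.exp_neg, one_div]
      exact inv_anti₀ (Real.exp_pos 1) (Real.exp_one_lt_d9.le.trans (by norm_num))
    have hxs : 1 / 3 * (μ * ((n : ℝ) / m)) ≤ x i * s i :=
      le_trans (by gcongr) (hcenter i).1
    have hsq : x i ^ 2 ≤ ‖d‖ ^ 2 := pow_le_pow_left₀ (hx i).le (hxd i) 2
    calc x i / s i = x i ^ 2 / (x i * s i) := by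
          have := (hx i).ne'
          have := (hs i).ne'
          field_simp
      _ ≤ ‖d‖ ^ 2 / (1 / 3 * (μ * ((n : ℝ) / m))) := by gcongr
      _ = 3 * m * ‖d‖ ^ 2 / (μ * n) := by field_simp
  have hC : 0 < 6 * (m : ℝ) * ‖d‖ ^ 2 / μ := by positivity
  have hM := posDef_transpose_mul_diagonal_mul hrank fun i => div_pos (hx i) (hs i)
  refine (dotProduct_self_le_mul_dotProduct_inv_mulVec hM hC _ ?_).trans_eq (by ring)
  generalize Aᵀ *ᵥ x - d = v
  have hA : ∑ i, (A *ᵥ v) i ^ 2 ≤ 2 * (n : ℝ) * (v ⬝ᵥ v) := by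
    simpa [dotProduct_transpose_mul_diagonal_mul_mulVec] using
      (dotProduct_transpose_mul_diagonal_mul_mulVec A (fun _ => 1) v).symm.trans_le
        (by simpa using heig v)
  calc v ⬝ᵥ ((Aᵀ * Matrix.diagonal (fun i => x i / s i) * A) *ᵥ v)
      = ∑ i, x i / s i * (A *ᵥ v) i ^ 2 := dotProduct_transpose_mul_diagonal_mul_mulVec ..
    _ ≤ ∑ i, 3 * m * ‖d‖ ^ 2 / (μ * n) * (A *ᵥ v) i ^ 2 := by
        exact Finset.sum_le_sum fun i _ => mul_le_mul_of_nonneg_right (hratio i) (sq_nonneg _)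
    _ = 3 * m * ‖d‖ ^ 2 / (μ * n) * ∑ i, (A *ᵥ v) i ^ 2 := (Finset.mul_sum ..).symm
    _ ≤ 3 * m * ‖d‖ ^ 2 / (μ * n) * (2 * (n : ℝ) * (v ⬝ᵥ v)) := by gcongr
    _ = 6 * (m : ℝ) * ‖d‖ ^ 2 / μ * (v ⬝ᵥ v) := by
        field_simp
        ring
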